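/- There exists a group Γ and a finite generating set S of Γ such that Γ has intermediate growth: the growth function β(k) = |B_S(k)| grows faster than every polynomial (for every d ≥ 0, β(k)/k^d → ∞ as k → ∞) and slower than every exponential (for every ε > 0, β(k) ≤ e^{εk} for all sufficiently large k; equivalently lim_{k→∞} β(k)^{1/k} = 1). -/

import Mathlib

open Pointwise

/-- `Γ`, generated by the finite set `S`, has intermediate growth: the ball sizes
`β(k) = |(S ∪ S⁻¹ ∪ {1})^k|` grow faster than every polynomial and slower than every
exponential. -/
def HasIntermediateGrowth (Γ : Type) [Group Γ] (S : Finset Γ) : Prop :=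
  Subgroup.closure (S : Set Γ) = ⊤ ∧
  (∀ d : ℕ, Filter.Tendsto
      (fun k : ℕ => (((((S : Set Γ) ∪ (S : Set Γ)⁻¹ ∪ {1}) ^ k).ncard : ℝ)) / (k : ℝ) ^ d)
      Filter.atTop Filter.atTop) ∧
  (∀ ε : ℝ, 0 < ε → ∀ᶠ k : ℕ in Filter.atTop,
      (((((S : Set Γ) ∪ (S : Set Γ)⁻¹ ∪ {1}) ^ k).ncard : ℝ)) ≤ Real.exp (ε * k))

namespace Grig

inductive V | e | b | c | d

namespace V
def s : V → Bool | e => false | b => true | c => true | d => false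
def next : V → V | e => e | b => c | c => d | d => b
def prev : V → V | e => e | c => b | d => c | b => d
def mul : V → V → V
  | e, y => y | x, e => x
  | b, b => e | b, c => d | b, d => c
  | c, b => d | c, c => e | c, d => b
  | d, b => c | d, c => b | d, d => e
def w : V → ℕ | e => 0 | b => 5 | c => 3 | d => 2
def num : V → ℕ | e => 0 | b => 1 | c => 2 | d => 3
lemma next_prev (x : V) : x.prev.next = x := by cases x <;> rfl
lemma next_mul (x y : V) : (mul x y).next = mul x.next y.next := by cases x <;> cases y <;> rfl
lemma s_mul (x y : V) : (mul x y).s = xor x.s y.s := by cases x <;> cases y <;> rfl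
lemma mul_self (x : V) : mul x x = e := by cases x <;> rfl
lemma w_mul (x y : V) : (mul x y).w ≤ x.w + y.w := by cases x <;> cases y <;> decide
lemma num_lt (x : V) : x.num < 4 := by cases x <;> decide
lemma num_inj {x y : V} (h : x.num = y.num) : x = y := by
  cases x <;> cases y <;> first | rfl | (simp [num] at h)
lemma finite : Finite V := Finite.of_injective (fun x : V => (⟨x.num, x.num_lt⟩ : Fin 4))
  (fun x y h => num_inj (by simpa using h))
end V

abbrev P := Equiv.Perm (List Bool)

def swapF : List Bool → List Bool
  | [] => []
  | x :: l => (!x) :: l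

def a : P := ⟨swapF, swapF, by intro l; cases l <;> simp [swapF], by intro l; cases l <;> simp [swapF]⟩

def actF : V → List Bool → List Bool
  | _, [] => []
  | x, false :: l => false :: (if x.s then swapF l else l)
  | x, true :: l => true :: actF x.next l

lemma swapF_swapF (l : List Bool) : swapF (swapF l) = l := by cases l <;> simp [swapF]

lemma actF_actF (x y : V) (l : List Bool) : actF x (actF y l) = actF (V.mul x y) l := by
  induction l generalizing x y with
  | nil => simp [actF]
  | cons i l ih =>
    cases i
    · simp only [actF, V.s_mul]
      cases x.s <;> cases y.s <;> simp [swapF_swapF]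
    · simp [actF, ih, V.next_mul]

lemma actF_e (l : List Bool) : actF V.e l = l := by
  induction l with
  | nil => simp [actF]
  | cons i l ih => cases i <;> simp [actF, V.s, V.next, ih]

def v (x : V) : P := ⟨actF x, actF x, by intro l; rw [actF_actF, V.mul_self, actF_e],
  by intro l; rw [actF_actF, V.mul_self, actF_e]⟩

def psiF (p q : List Bool → List Bool) : List Bool → List Bool
  | [] => []
  | false :: l => false :: p l
  | true :: l => true :: q l

def psi (p q : P) : P := ⟨psiF p q, psiF p.symm q.symm,
  by intro l; rcases l with _ | ⟨_ | _, l⟩ <;> simp [psiF],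
  by intro l; rcases l with _ | ⟨_ | _, l⟩ <;> simp [psiF]⟩

lemma a_apply (l) : a l = swapF l := rfl
lemma v_apply (x l) : v x l = actF x l := rfl
lemma psi_apply (p q l) : psi p q l = psiF p q l := rfl

lemma a_mul_a : a * a = 1 := by
  ext1 l; simp [Equiv.Perm.mul_apply, a_apply, swapF_swapF]
lemma v_mul_v (x y : V) : v x * v y = v (V.mul x y) := by
  ext1 l; simp [Equiv.Perm.mul_apply, v_apply, actF_actF]
lemma v_e : v V.e = 1 := by
  ext1 l; simp [v_apply, actF_e]
lemma v_mul_self (x : V) : v x * v x = 1 := by rw [v_mul_v, V.mul_self, v_e]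
lemma a_inv : a⁻¹ = a := inv_eq_of_mul_eq_one_left a_mul_a
lemma v_inv (x : V) : (v x)⁻¹ = v x := inv_eq_of_mul_eq_one_left (v_mul_self x)
lemma psi_mul (p q p' q' : P) : psi p q * psi p' q' = psi (p * p') (q * q') := by
  ext1 l; rcases l with _ | ⟨_ | _, l⟩ <;> simp [Equiv.Perm.mul_apply, psi_apply, psiF]
lemma psi_one : psi 1 1 = 1 := by
  ext1 l; rcases l with _ | ⟨_ | _, l⟩ <;> simp [psi_apply, psiF]
lemma a_psi_a (p q : P) : a * psi p q * a = psi q p := by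
  ext1 l; rcases l with _ | ⟨_ | _, l⟩ <;>
    simp [Equiv.Perm.mul_apply, psi_apply, psiF, a_apply, swapF]
lemma a_psi (p q : P) : a * psi p q = psi q p * a := by
  rw [← a_psi_a p q, mul_assoc, a_mul_a, mul_one]
lemma psi_inj {p q p' q' : P} (h : psi p q = psi p' q') : p = p' ∧ q = q' := by
  constructor
  · ext1 l
    have := congrArg (fun f : P => f (false :: l)) h
    simpa [psi_apply, psiF] using this
  · ext1 l
    have := congrArg (fun f : P => f (true :: l)) h
    simpa [psi_apply, psiF] using this
lemma psi_ne_a (p q : P) : psi p q ≠ a := by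
  intro h
  have := congrArg (fun f : P => f [true]) h
  simp [psi_apply, psiF, a_apply, swapF] at this

def sg : Bool → P | true => a | false => 1

lemma v_eq (x : V) : v x = psi (sg x.s) (v x.next) := by
  ext1 l; rcases l with _ | ⟨_ | _, l⟩ <;>
    simp [v_apply, psi_apply, psiF, actF]
  cases x.s <;> simp [sg, a_apply]

/-! words -/
def ev : List V → P
  | [] => 1
  | x :: l => v x * a * ev l

def wt : List V → ℕ
  | [] => 0
  | x :: l => x.w + 5 + wt l

def Rep (g : P) (n : ℕ) : Prop := ∃ x l, ev (x :: l) = g ∧ wt (x :: l) ≤ n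

lemma rep_one : Rep 1 10 := ⟨V.e, [V.e], by simp [ev, v_e, a_mul_a], by simp [wt, V.w]⟩
lemma rep_a {g n} (h : Rep g n) : Rep (a * g) (n + 5) := by
  obtain ⟨x, l, rfl, h⟩ := h
  exact ⟨V.e, x :: l, by simp [ev, v_e], by simp only [wt, V.w] at h ⊢; omega⟩
lemma rep_v {g n} (y : V) (h : Rep g n) : Rep (v y * g) (n + y.w) := by
  obtain ⟨x, l, rfl, h⟩ := h
  refine ⟨V.mul y x, l, by simp [ev, ← v_mul_v, mul_assoc], ?_⟩
  have := V.w_mul y x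
  simp only [wt] at h ⊢; omega

def sw : Bool → ℕ | true => 5 | false => 0
lemma rep_sg {g n} (y : Bool) (h : Rep g n) : Rep (sg y * g) (n + sw y) := by
  cases y
  · simpa [sg, sw] using h
  · exact rep_a h

lemma cost (x : V) : 8 * (sw x.s + x.next.w) ≤ 7 * (x.w + 5) := by cases x <;> decide

lemma split (l : List V) : ∃ (t : Bool) (g0 g1 : P) (n0 n1 : ℕ), Rep g0 n0 ∧ Rep g1 n1 ∧
    ev l = psi g0 g1 * sg t ∧ 8 * (n0 + n1) ≤ 7 * wt l + 160 := by
  induction l with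
  | nil => exact ⟨false, 1, 1, 10, 10, rep_one, rep_one, by simp [ev, psi_one, sg], by simp [wt]⟩
  | cons x l ih =>
    obtain ⟨t, g0, g1, n0, n1, h0, h1, h, hn⟩ := ih
    refine ⟨!t, sg x.s * g1, v x.next * g0, n1 + sw x.s, n0 + x.next.w, rep_sg _ h1, rep_v _ h0,
      ?_, ?_⟩
    · have : a * sg t = sg (!t) := by cases t <;> simp [sg, a_mul_a]
      rw [ev, h, v_eq x, mul_assoc, ← mul_assoc a, a_psi, mul_assoc (psi g1 g0), this, ← mul_assoc,
        psi_mul]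
    · have := cost x
      simp only [wt]; omega

noncomputable def L (g : P) : ℕ := sInf {n | ∃ l, ev l = g ∧ wt l = n}

lemma L_le (l : List V) : L (ev l) ≤ wt l := Nat.sInf_le ⟨l, rfl, rfl⟩
lemma exists_L (g : Set.range ev) : ∃ l, ev l = g ∧ wt l = L g := by
  obtain ⟨g, l, rfl⟩ := g
  exact Nat.sInf_mem (s := {n | ∃ l', ev l' = ev l ∧ wt l' = n}) ⟨_, l, rfl, rfl⟩
lemma Rep.mem {g n} (h : Rep g n) : g ∈ Set.range ev := by
  obtain ⟨x, l, h, _⟩ := h; exact ⟨_, h⟩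
lemma Rep.L_le {g n} (h : Rep g n) : L g ≤ n := by
  obtain ⟨x, l, rfl, h⟩ := h; exact (Grig.L_le _).trans h

lemma split' (g : Set.range ev) : ∃ z : Bool × (Set.range ev × Set.range ev),
    (g : P) = psi z.2.1 z.2.2 * sg z.1 ∧ 8 * (L z.2.1 + L z.2.2) ≤ 7 * L g + 160 := by
  obtain ⟨l, hl, hw⟩ := exists_L g
  obtain ⟨t, g0, g1, n0, n1, h0, h1, h, hn⟩ := split l
  refine ⟨(t, ⟨g0, h0.mem⟩, ⟨g1, h1.mem⟩), by rw [← hl, h], ?_⟩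
  have := h0.L_le
  have := h1.L_le
  rw [← hw]
  simp only; omega

def Z (s : ℝ) : Prop := Summable (fun g : Set.range ev => Real.exp (-(s * L g)))

lemma Z_step {s : ℝ} (hs : 0 < s) (h : Z (8 / 7 * s)) : Z s := by
  choose f hf hf2 using split'
  have hinj : Function.Injective f := by
    intro g g' h
    apply Subtype.ext
    rw [hf g, hf g', h]
  have h2 := Summable.mul_of_nonneg h h (fun _ => (Real.exp_pos _).le) (fun _ => (Real.exp_pos _).le)
  have h3 : Summable (fun _ : Bool => (1:ℝ)) := (hasSum_fintype _).summable
  have h4 := Summable.mul_of_nonneg h3 h2 (fun _ => zero_le_one) (fun _ => by positivity)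
  have h5 := (h4.comp_injective hinj).mul_left (Real.exp (160 / 7 * s))
  refine Summable.of_nonneg_of_le (fun _ => (Real.exp_pos _).le) (fun g => ?_) h5
  simp only [Function.comp, one_mul, ← Real.exp_add]
  apply Real.exp_le_exp.2
  have h6 : (8 * (L (f g).2.1 + L (f g).2.2) : ℝ) ≤ 7 * L g + 160 := by exact_mod_cast hf2 g
  nlinarith

def code : List V → ℕ
  | [] => 0
  | x :: l => 4 * code l + x.num + 1

lemma code_inj : Function.Injective code := by
  intro l
  induction l with
  | nil => intro l' h; cases l' with
    | nil => rfl
    | cons x l' => simp [code] at h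
  | cons x l ih =>
    intro l' h
    cases l' with
    | nil => simp [code] at h
    | cons y l' =>
      simp only [code] at h
      have := x.num_lt
      have := y.num_lt
      rw [V.num_inj (show x.num = y.num by omega), ih (show code l = code l' by omega)]

lemma code_le (l : List V) : ((code l : ℝ) + 1) ≤ Real.exp (wt l) := by
  induction l with
  | nil => simp [code, wt]
  | cons x l ih =>
    have h1 : (x.num : ℝ) ≤ 3 := by exact_mod_cast Nat.lt_succ_iff.1 x.num_lt
    have h2 : (5 : ℝ) ≤ Real.exp (x.w + 5) := by
      have := Real.add_one_le_exp ((x.w : ℝ) + 5)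
      have : (0:ℝ) ≤ x.w := by positivity
      linarith
    simp only [code, wt]
    push_cast
    rw [Real.exp_add]
    calc (4 * (code l : ℝ) + x.num + 1 + 1) ≤ 5 * (code l + 1) := by
          have : (0:ℝ) ≤ code l := by positivity
          linarith
      _ ≤ _ := by gcongr

lemma Z_two : Z 2 := by
  choose f hf hf2 using exists_L
  have hinj : Function.Injective (fun g => code (f g)) := by
    intro g g' h
    apply Subtype.ext
    rw [← hf g, ← hf g', code_inj h]
  have h1 : Summable (fun n : ℕ => 1 / ((n : ℝ) + 1) ^ 2) := by
    have := (summable_nat_add_iff 1).2 (Real.summable_one_div_nat_pow.2 (one_lt_two))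
    simpa using this
  refine Summable.of_nonneg_of_le (fun _ => (Real.exp_pos _).le) (fun g => ?_) (h1.comp_injective hinj)
  simp only [Function.comp]
  rw [Real.exp_neg, ← one_div, ← hf2 g]
  apply one_div_le_one_div_of_le (by positivity)
  have := code_le (f g)
  calc ((code (f g) : ℝ) + 1) ^ 2 ≤ (Real.exp (wt (f g))) ^ 2 := by gcongr
    _ = _ := by rw [← Real.exp_nat_mul]; norm_num

lemma Z_mono {s t : ℝ} (hst : s ≤ t) (h : Z s) : Z t := by
  refine Summable.of_nonneg_of_le (fun _ => (Real.exp_pos _).le) (fun g => ?_) h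
  apply Real.exp_le_exp.2
  have : (0:ℝ) ≤ L g := by positivity
  nlinarith

lemma Z_pow (n : ℕ) : Z ((7 / 8) ^ n * 2) := by
  induction n with
  | zero => simpa using Z_two
  | succ n ih =>
    apply Z_step (by positivity)
    convert ih using 1
    rw [pow_succ]; ring

lemma Z_all {s : ℝ} (hs : 0 < s) : Z s := by
  obtain ⟨n, hn⟩ := exists_pow_lt_of_lt_one (show 0 < s / 2 by positivity) (show (7/8:ℝ) < 1 by norm_num)
  exact Z_mono (by linarith) (Z_pow n)

def T : Set P := insert a (Set.range v)

lemma T_fin : T.Finite := by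
  have := V.finite
  exact (Set.finite_range v).insert a
lemma one_T : (1 : P) ∈ T := Or.inr ⟨V.e, v_e⟩
lemma a_T : a ∈ T := Or.inl rfl
lemma v_T (x : V) : v x ∈ T := Or.inr ⟨x, rfl⟩

lemma T_eq : T ∪ T⁻¹ ∪ {1} = T := by
  apply Set.Subset.antisymm
  · rintro g ((h | h) | h)
    · exact h
    · rcases h with h | ⟨x, h⟩
      · rw [inv_eq_iff_eq_inv, a_inv] at h; exact h ▸ a_T
      · have : g = v x := by rw [← inv_inv g, ← h, v_inv]
        exact this ▸ v_T x
    · rw [Set.mem_singleton_iff.1 h]; exact one_T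
  · intro g h; exact Or.inl (Or.inl h)

lemma T_pow_rep (k : ℕ) : ∀ g ∈ T ^ k, Rep g (10 + 5 * k) := by
  induction k with
  | zero => intro g hg; simp at hg; rw [hg]; exact rep_one
  | succ k ih =>
    intro g hg
    rw [pow_succ'] at hg
    obtain ⟨t, ht, g, hg', rfl⟩ := Set.mem_mul.1 hg
    rcases ht with rfl | ⟨x, rfl⟩
    · exact rep_a (ih g hg')
    · obtain ⟨y, l, h, hw⟩ := rep_v x (ih g hg')
      refine ⟨y, l, h, hw.trans ?_⟩
      have : x.w ≤ 5 := by cases x <;> decide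
      omega

lemma T_pow_fin (k : ℕ) : (T ^ k).Finite := by
  induction k with
  | zero => simp
  | succ k ih => rw [pow_succ]; exact Set.Finite.mul ih T_fin

noncomputable def beta (k : ℕ) : ℕ := (T ^ k).ncard

lemma beta_upper {s : ℝ} (hs : 0 < s) : ∃ C : ℝ, 0 < C ∧ ∀ k : ℕ, (beta k : ℝ) ≤ C * Real.exp (5 * s * k) := by
  have hZ : Summable _ := Z_all hs
  refine ⟨(∑' g : Set.range ev, Real.exp (-(s * L g))) * Real.exp (10 * s) + 1, by positivity, fun k => ?_⟩
  have hsub : T ^ k ⊆ Set.range ev := fun g hg => (T_pow_rep k g hg).mem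
  have hfin := (T_pow_fin k).preimage (Subtype.val_injective (p := (· ∈ Set.range ev))).injOn
  have h1 := hZ.sum_le_tsum hfin.toFinset (fun _ _ => (Real.exp_pos _).le)
  have h2 : beta k = hfin.toFinset.card := by
    rw [← Set.ncard_eq_toFinset_card _ hfin, beta]
    rw [← Set.ncard_image_of_injective _ (Subtype.val_injective (p := (· ∈ Set.range ev)))]
    congr 1
    rw [Subtype.image_preimage_coe, Set.inter_eq_right.2 hsub]
  have h3 : (hfin.toFinset.card : ℝ) * Real.exp (-(s * (10 + 5 * k))) ≤
      ∑ g ∈ hfin.toFinset, Real.exp (-(s * L g)) := by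
    rw [← nsmul_eq_mul]
    apply Finset.card_nsmul_le_sum
    intro g hg
    apply Real.exp_le_exp.2
    have := (T_pow_rep k g (by simpa using hg)).L_le
    have : (L g : ℝ) ≤ 10 + 5 * k := by exact_mod_cast this
    nlinarith
  rw [← h2] at h3
  have h4 := h3.trans h1
  rw [Real.exp_neg, ← div_eq_mul_inv, div_le_iff₀ (by positivity)] at h4
  refine h4.trans ?_
  rw [show s * (10 + 5 * (k:ℝ)) = 10 * s + 5 * s * k by ring, Real.exp_add, ← mul_assoc]
  gcongr
  linarith

lemma upper (ε : ℝ) (hε : 0 < ε) : ∀ᶠ k : ℕ in Filter.atTop, (beta k : ℝ) ≤ Real.exp (ε * k) := by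
  obtain ⟨C, hC, h⟩ := beta_upper (show 0 < ε / 10 by positivity)
  filter_upwards [(tendsto_natCast_atTop_atTop (R := ℝ)).eventually_ge_atTop (Real.log C / (ε / 2))] with k hk
  refine (h k).trans ?_
  rw [div_le_iff₀ (by positivity)] at hk
  rw [← Real.exp_log hC, ← Real.exp_add, Real.exp_le_exp]
  linarith

/-! lower bound -/
lemma exists_D : ∃ D : Set P, D.Finite ∧ 1 ∈ D ∧ ∀ g ∈ D, a * g ∈ D ∧ v V.d * g ∈ D := by
  set d := v V.d with hd
  have dd : d * d = 1 := v_mul_self _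
  have hdp : d = psi 1 (v V.b) := v_eq V.d
  have hada : a * (d * a) = psi (v V.b) 1 := by rw [hdp, ← mul_assoc, a_psi_a]
  have r : d * (a * (d * a)) = a * (d * (a * d)) := by
    rw [hada]
    rw [show a * (d * (a * d)) = (a * (d * a)) * d by simp only [mul_assoc], hada, hdp, psi_mul, psi_mul]
    simp
  have aa : ∀ g, a * (a * g) = g := fun g => by rw [← mul_assoc, a_mul_a, one_mul]
  have dd' : ∀ g, d * (d * g) = g := fun g => by rw [← mul_assoc, dd, one_mul]
  refine ⟨{1, a, a * d, a * (d * a), a * (d * (a * d)), d, d * a, d * (a * d)}, Set.toFinite _, by simp, ?_⟩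
  intro g hg
  simp only [Set.mem_insert_iff, Set.mem_singleton_iff] at hg ⊢
  rcases hg with rfl | rfl | rfl | rfl | rfl | rfl | rfl | rfl
  · simp
  · simp [a_mul_a]
  · simp [aa]
  · simp [aa, r]
  · refine ⟨by simp [aa], ?_⟩
    rw [← r, dd']; simp
  · simp [dd]
  · simp [dd']
  · simp [dd']

lemma beta_mono : Monotone beta := fun m n h =>
  Set.ncard_le_ncard (Set.pow_subset_pow_right one_T h) (T_pow_fin n)

lemma lift {D : Set P} (h1 : 1 ∈ D) (hD : ∀ g ∈ D, a * g ∈ D ∧ v V.d * g ∈ D) (n : ℕ) :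
    ∀ g ∈ T ^ n, ∃ δ ∈ D, psi δ g ∈ T ^ (3 * n) := by
  induction n with
  | zero => intro g hg; simp at hg; subst hg; exact ⟨1, h1, by simp [psi_one]⟩
  | succ n ih =>
    intro g hg
    rw [pow_succ'] at hg
    obtain ⟨t, ht, g, hg', rfl⟩ := Set.mem_mul.1 hg
    obtain ⟨δ, hδ, h⟩ := ih g hg'
    rw [show 3 * (n + 1) = 3 + 3 * n by ring, pow_add]
    rcases ht with rfl | ⟨x, rfl⟩
    · refine ⟨v V.d * δ, (hD δ hδ).2, ?_⟩
      rw [← psi_mul]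
      refine Set.mul_mem_mul ?_ h
      have : psi (v V.d) a = a * v V.c * a := by rw [v_eq V.c, a_psi_a]; rfl
      rw [this, pow_succ, pow_two]
      exact Set.mul_mem_mul (Set.mul_mem_mul a_T (v_T _)) a_T
    · refine ⟨sg x.prev.s * δ, ?_, ?_⟩
      · cases x.prev.s
        · simpa [sg] using hδ
        · exact (hD δ hδ).1
      · rw [← psi_mul]
        refine Set.mul_mem_mul ?_ h
        have := v_eq x.prev
        rw [V.next_prev] at this
        rw [← this]
        exact Set.pow_subset_pow_right one_T (show 1 ≤ 3 by norm_num) (by simpa using v_T _)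

lemma beta_double : ∃ M : ℕ, 0 < M ∧ ∀ n, 1 ≤ n → beta n ^ 2 ≤ M * beta (8 * n) := by
  obtain ⟨D, hfin, h1, hD⟩ := exists_D
  refine ⟨(D ×ˢ D).ncard, ?_, fun n hn => ?_⟩
  · rw [Set.ncard_pos (hfin.prod hfin)]; exact ⟨(1, 1), h1, h1⟩
  have H : ∀ g : P, ∃ δ : P, g ∈ T ^ n → δ ∈ D ∧ psi δ g ∈ T ^ (3 * n) := by
    intro g
    by_cases hg : g ∈ T ^ n
    · obtain ⟨δ, h⟩ := lift h1 hD n g hg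
      exact ⟨δ, fun _ => h⟩
    · exact ⟨1, fun h => absurd h hg⟩
  choose δ hδ using H
  have e1 : beta n ^ 2 = ((T ^ n) ×ˢ (T ^ n)).ncard := by rw [Set.ncard_prod, pow_two, beta]
  have e2 : (D ×ˢ D).ncard * beta (8 * n) = ((D ×ˢ D) ×ˢ (T ^ (8 * n))).ncard := by
    rw [Set.ncard_prod (s := D ×ˢ D), beta]
  rw [e1, e2]
  refine Set.ncard_le_ncard_of_injOn
    (fun p : P × P => ((δ p.1, δ p.2), psi (δ p.1) p.1 * (a * psi (δ p.2) p.2 * a))) ?_ ?_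
    ((hfin.prod hfin).prod (T_pow_fin _))
  · rintro ⟨g, g'⟩ ⟨hg, hg'⟩
    obtain ⟨h1, h2⟩ := hδ g hg
    obtain ⟨h3, h4⟩ := hδ g' hg'
    refine ⟨⟨h1, h3⟩, ?_⟩
    have : psi (δ g) g * (a * psi (δ g') g' * a) ∈ T ^ (3 * n + (1 + 3 * n + 1)) := by
      rw [pow_add, pow_add _ (1 + 3 * n), pow_add _ 1, pow_one]
      exact Set.mul_mem_mul h2 (Set.mul_mem_mul (Set.mul_mem_mul a_T h4) a_T)
    exact Set.pow_subset_pow_right one_T (by omega) this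
  · rintro ⟨g, g'⟩ _ ⟨k, k'⟩ _ h
    simp only [Prod.mk.injEq, a_psi_a, psi_mul] at h
    obtain ⟨⟨h1, h2⟩, h3⟩ := h
    obtain ⟨h4, h5⟩ := psi_inj h3
    rw [h1] at h4
    rw [h2] at h5
    rw [mul_left_cancel h4, mul_right_cancel h5]

lemma G_inf : (⋃ n, T ^ n).Infinite := by
  intro hfin
  obtain ⟨D, -, h1, hD⟩ := exists_D
  have H : ∀ g : (⋃ n, T ^ n : Set P), ∃ h : (⋃ n, T ^ n : Set P), ∃ δ, (h : P) = psi δ g := by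
    rintro ⟨g, hg⟩
    obtain ⟨n, hn⟩ := Set.mem_iUnion.1 hg
    obtain ⟨δ, -, h⟩ := lift h1 hD n g hn
    exact ⟨⟨_, Set.mem_iUnion.2 ⟨_, h⟩⟩, δ, rfl⟩
  choose f δ hf using H
  have : Finite (⋃ n, T ^ n : Set P) := hfin
  have hinj : Function.Injective f := by
    intro g g' h
    have := hf g
    rw [h, hf g'] at this
    exact Subtype.ext (psi_inj this).2.symm
  obtain ⟨g, hg⟩ := (Finite.injective_iff_surjective.1 hinj) ⟨a, Set.mem_iUnion.2 ⟨1, by simpa using a_T⟩⟩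
  have := hf g
  rw [hg] at this
  exact psi_ne_a _ _ this.symm

lemma beta_unbdd (M : ℕ) : ∃ n, 1 ≤ n ∧ M ≤ beta n := by
  obtain ⟨F, hF, hc⟩ := G_inf.exists_subset_card_eq M
  have H : ∀ g ∈ F, ∃ n, g ∈ T ^ n := fun g hg => Set.mem_iUnion.1 (hF hg)
  choose! f hf using H
  refine ⟨F.sup f + 1, by omega, ?_⟩
  rw [← hc, ← Set.ncard_coe_finset]
  refine Set.ncard_le_ncard (fun g hg => ?_) (T_pow_fin _)
  have : f g ≤ F.sup f := Finset.le_sup hg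
  exact Set.pow_subset_pow_right one_T (by omega) (hf g hg)

lemma beta_poly (d : ℕ) : ∃ n0 : ℕ, 1 ≤ n0 ∧ ∀ k, n0 ≤ k → k ^ d ≤ n0 ^ d * beta k := by
  obtain ⟨M, hM, h⟩ := beta_double
  obtain ⟨n0, hn0, hb⟩ := beta_unbdd (M * 8 ^ d)
  have key : ∀ j, M * (8 ^ d) ^ (j + 1) ≤ beta (8 ^ j * n0) := by
    intro j
    induction j with
    | zero => simpa using hb
    | succ j ih =>
      have h1 := h (8 ^ j * n0) (Nat.one_le_iff_ne_zero.2 (by positivity))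
      rw [← mul_assoc, ← pow_succ'] at h1
      have h2 := (Nat.pow_le_pow_left ih 2).trans h1
      have h3 : M * (M * (8 ^ d) ^ (2 * (j + 1))) ≤ M * beta (8 ^ (j + 1) * n0) := by
        refine le_trans (le_of_eq ?_) h2
        ring
      refine le_trans ?_ (Nat.le_of_mul_le_mul_left h3 hM)
      gcongr
      · exact Nat.one_le_pow _ _ (by norm_num)
      · omega
  refine ⟨n0, hn0, fun k hk => ?_⟩
  set j := Nat.log 8 (k / n0)
  have hk0 : k / n0 ≠ 0 := (Nat.div_pos hk (by omega)).ne'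
  have h1 : 8 ^ j * n0 ≤ k :=
    (Nat.mul_le_mul_right _ (Nat.pow_log_le_self 8 hk0)).trans (Nat.div_mul_le_self k n0)
  have h2 : k < 8 ^ (j + 1) * n0 :=
    (Nat.div_lt_iff_lt_mul (by omega)).1 (Nat.lt_pow_succ_log_self (by norm_num) _)
  calc k ^ d ≤ (8 ^ (j + 1) * n0) ^ d := Nat.pow_le_pow_left h2.le d
    _ = n0 ^ d * (1 * (8 ^ d) ^ (j + 1)) := by ring
    _ ≤ n0 ^ d * (M * (8 ^ d) ^ (j + 1)) := by gcongr; exact hM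
    _ ≤ n0 ^ d * beta k := by gcongr; exact (key j).trans (beta_mono h1)

lemma lower (d : ℕ) : Filter.Tendsto (fun k : ℕ => (beta k : ℝ) / (k : ℝ) ^ d) Filter.atTop Filter.atTop := by
  obtain ⟨n0, hn0, h⟩ := beta_poly (d + 1)
  have hn0' : (0:ℝ) < n0 := by exact_mod_cast hn0
  have ht : Filter.Tendsto (fun k : ℕ => (k : ℝ) / (n0 : ℝ) ^ (d + 1)) Filter.atTop Filter.atTop :=
    tendsto_natCast_atTop_atTop.atTop_div_const (by positivity)
  refine Filter.tendsto_atTop_mono' _ ?_ ht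
  filter_upwards [Filter.eventually_ge_atTop n0] with k hk
  have hk0 : (0:ℝ) < k := by exact_mod_cast (lt_of_lt_of_le hn0 hk)
  rw [div_le_div_iff₀ (by positivity) (by positivity)]
  have : (k:ℝ) ^ (d + 1) ≤ n0 ^ (d + 1) * beta k := by exact_mod_cast h k hk
  rw [pow_succ] at this
  linarith

end Grig

/-- Grigorchuk (1983–84): there exists a finitely generated group of intermediate growth. -/
theorem exists_group_of_intermediate_growth :
    ∃ (Γ : Type) (inst : Group Γ) (S : Finset Γ), @HasIntermediateGrowth Γ inst S := by
  have hinj := Subtype.val_injective (p := (· ∈ Subgroup.closure Grig.T))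
  have hfin := Grig.T_fin.preimage hinj.injOn
  refine ⟨Subgroup.closure Grig.T, inferInstance, hfin.toFinset, ?_⟩
  have key : ∀ k : ℕ, (((hfin.toFinset : Set (Subgroup.closure Grig.T)) ∪
      (hfin.toFinset : Set (Subgroup.closure Grig.T))⁻¹ ∪ {1}) ^ k).ncard = Grig.beta k := by
    intro k
    rw [Grig.beta, ← Set.ncard_image_of_injective _ hinj]
    congr 1
    have := Set.image_pow (Subgroup.closure Grig.T).subtype ((hfin.toFinset : Set (Subgroup.closure Grig.T)) ∪
      (hfin.toFinset : Set (Subgroup.closure Grig.T))⁻¹ ∪ {1}) k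
    refine this.trans ?_
    congr 1
    have h1 : (Subgroup.closure Grig.T).subtype '' (hfin.toFinset : Set (Subgroup.closure Grig.T)) = Grig.T := by
      rw [Set.Finite.coe_toFinset]
      exact (Subtype.image_preimage_coe _ _).trans (Set.inter_eq_right.2 Subgroup.subset_closure)
    rw [Set.image_union, Set.image_union, Set.image_inv, h1, Set.image_singleton, map_one, Grig.T_eq]
  refine ⟨?_, ?_, ?_⟩
  · rw [Set.Finite.coe_toFinset]
    exact Subgroup.closure_closure_coe_preimage
  · intro d
    simp only [key]
    exact Grig.lower d
  · intro ε hε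
    simp only [key]
    exact Grig.upper ε hε
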